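/- Let M(t) be an n×n matrix of functions analytic in a neighbourhood of t_0 ∈ ℂ, and let γ = Γ_1, Γ_2, …, Γ_n be ℂⁿ-valued analytic solutions of the linear system x′ = M(t)x forming a fundamental system, i.e. det(Γ_1, …, Γ_n)(t_0) ≠ 0. Let h be a linear form on ℂⁿ, set y_i = h∘Γ_i for i = 1, …, n, and assume y_1 = h∘γ is not identically zero. Let y_{i_1}, …, y_{i_l} be a maximal ℂ-linearly independent subfamily of (y_1, …, y_n) and let W be its Wronskian determinant (analytic and not identically zero near t_0). Then ord_{t_0}(h∘γ) ≤ n−1 + ord_{t_0} W. -/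

import Mathlib

open scoped BigOperators

/-- The order of vanishing at `t₀` of a function analytic near `t₀`. -/
noncomputable def ordAt (f : ℂ → ℂ) (t₀ : ℂ) : ℕ := sInf {k | iteratedDeriv k f t₀ ≠ 0}

/-- The Wronskian determinant `W(z₁, …, z_l)(t) = det(z_j^{(k)}(t))`. -/
noncomputable def wronskian {l : ℕ} (z : Fin l → ℂ → ℂ) : ℂ → ℂ :=
  fun t => (Matrix.of fun k j : Fin l => iteratedDeriv (k : ℕ) (z j) t).det

theorem analyticAt_matrix_det {l : ℕ} {A : ℂ → Matrix (Fin l) (Fin l) ℂ} {t₀ : ℂ}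
    (hA : ∀ i j, AnalyticAt ℂ (fun t => A t i j) t₀) :
    AnalyticAt ℂ (fun t => (A t).det) t₀ := by
  simp only [Matrix.det_apply']
  exact Finset.analyticAt_fun_sum _ fun σ _ =>
    analyticAt_const.mul (Finset.analyticAt_fun_prod _ fun i _ => hA _ _)

theorem analyticAt_matrix_adjugate {l : ℕ} {A : ℂ → Matrix (Fin l) (Fin l) ℂ} {t₀ : ℂ}
    (hA : ∀ i j, AnalyticAt ℂ (fun t => A t i j) t₀) (i j : Fin l) :
    AnalyticAt ℂ (fun t => (A t).adjugate i j) t₀ := by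
  simp only [Matrix.adjugate_apply]
  refine analyticAt_matrix_det fun p q => ?_
  by_cases h : p = j
  · subst h
    simpa using analyticAt_const
  · simpa [Matrix.updateRow_ne h] using hA p q

theorem AnalyticAt.iteratedDeriv' {f : ℂ → ℂ} {t₀ : ℂ} (hf : AnalyticAt ℂ f t₀) (k : ℕ) :
    AnalyticAt ℂ (iteratedDeriv k f) t₀ := by
  rw [iteratedDeriv_eq_iterate]
  exact hf.iterated_deriv k

theorem analyticAt_wronskian {l : ℕ} {z : Fin l → ℂ → ℂ} {t₀ : ℂ}
    (hz : ∀ j, AnalyticAt ℂ (z j) t₀) : AnalyticAt ℂ (wronskian z) t₀ :=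
  analyticAt_matrix_det fun k j => (hz j).iteratedDeriv' k

theorem iteratedDeriv_linear_combination {l : ℕ} {z : Fin l → ℂ → ℂ} {t : ℂ}
    (hz : ∀ j, AnalyticAt ℂ (z j) t) (a : Fin l → ℂ) (k : ℕ) :
    iteratedDeriv k (fun s => ∑ j, a j * z j s) t = ∑ j, a j * iteratedDeriv k (z j) t := by
  rw [iteratedDeriv_fun_sum fun j _ => contDiffAt_const.mul (hz j).contDiffAt]
  exact Finset.sum_congr rfl fun j _ => iteratedDeriv_const_mul _ (hz j).contDiffAt

theorem natCast_ordAt {f : ℂ → ℂ} {t₀ : ℂ} (hf : AnalyticAt ℂ f t₀)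
    (h0 : ¬ ∀ᶠ t in nhds t₀, f t = 0) : (ordAt f t₀ : ℕ∞) = analyticOrderAt f t₀ := by
  obtain ⟨m, hm⟩ := ENat.ne_top_iff_exists.mp (mt analyticOrderAt_eq_top.mp h0)
  obtain ⟨hlt, hne⟩ := (analyticOrderAt_eq_nat_iff_iteratedDeriv_eq_zero hf).mp hm.symm
  rw [← hm, Nat.cast_inj]
  exact le_antisymm (Nat.sInf_le hne)
    (le_csInf ⟨m, hne⟩ fun k hk => not_lt.mp fun hkm => hk (hlt k hkm))

theorem analyticOrderAt_le_iteratedDeriv_add {f : ℂ → ℂ} {t₀ : ℂ} (hf : AnalyticAt ℂ f t₀)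
    {d k : ℕ} (h : ((d + k : ℕ) : ℕ∞) ≤ analyticOrderAt f t₀) :
    (d : ℕ∞) ≤ analyticOrderAt (iteratedDeriv k f) t₀ := by
  rw [natCast_le_analyticOrderAt_iff_iteratedDeriv_eq_zero hf] at h
  rw [natCast_le_analyticOrderAt_iff_iteratedDeriv_eq_zero (hf.iteratedDeriv' k)]
  intro i hi
  have := h (i + k) (by omega)
  rwa [iteratedDeriv_eq_iterate, Function.iterate_add_apply, ← iteratedDeriv_eq_iterate,
    ← iteratedDeriv_eq_iterate] at this

theorem le_analyticOrderAt_sum {α : Type*} (s : Finset α) {f : α → ℂ → ℂ} {t₀ : ℂ} {d : ℕ∞}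
    (h : ∀ i ∈ s, d ≤ analyticOrderAt (f i) t₀) :
    d ≤ analyticOrderAt (∑ i ∈ s, f i) t₀ := by
  classical
  induction s using Finset.induction_on with
  | empty =>
    have h0 : analyticOrderAt (0 : ℂ → ℂ) t₀ = ⊤ :=
      analyticOrderAt_eq_top.mpr (Filter.Eventually.of_forall fun _ => rfl)
    rw [Finset.sum_empty, h0]
    exact le_top
  | insert i s hi ih =>
    rw [Finset.sum_insert hi]
    exact (le_min (h i (Finset.mem_insert_self i s))
      (ih fun j hj => h j (Finset.mem_insert_of_mem hj))).trans le_analyticOrderAt_add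

/-- Replacing a column of the Wronskian matrix by a linear combination `f` shows that the
Wronskian vanishes at least to the order of `f` minus `l - 1`. -/
theorem le_analyticOrderAt_wronskian {l : ℕ} {z : Fin l → ℂ → ℂ} {f : ℂ → ℂ} {t₀ : ℂ}
    (hz : ∀ j, AnalyticAt ℂ (z j) t₀) {a : Fin l → ℂ} {j₀ : Fin l} (ha : a j₀ ≠ 0)
    (hf : f =ᶠ[nhds t₀] fun t => ∑ j, a j * z j t) {d : ℕ}
    (hd : ((d + (l - 1) : ℕ) : ℕ∞) ≤ analyticOrderAt f t₀) :
    (d : ℕ∞) ≤ analyticOrderAt (wronskian z) t₀ := by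
  have hfa : AnalyticAt ℂ f t₀ :=
    (Finset.analyticAt_fun_sum _ fun j _ => analyticAt_const.mul (hz j)).congr hf.symm
  set B : ℂ → Matrix (Fin l) (Fin l) ℂ :=
    fun t => Matrix.of fun k j : Fin l => iteratedDeriv (k : ℕ) (z j) t with hB
  have hBa : ∀ k j, AnalyticAt ℂ (fun t => B t k j) t₀ := fun k j => (hz j).iteratedDeriv' k
  have key : wronskian z =ᶠ[nhds t₀]
      ∑ k : Fin l, (fun t => (a j₀)⁻¹ * (B t).adjugate j₀ k) * iteratedDeriv k f := by
    have hev : ∀ᶠ t in nhds t₀, ∀ j, AnalyticAt ℂ (z j) t :=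
      Filter.eventually_all.mpr fun j => (hz j).eventually_analyticAt
    have hfk : ∀ᶠ t in nhds t₀, ∀ k : Fin l,
        iteratedDeriv k f t = iteratedDeriv k (fun t => ∑ j, a j * z j t) t :=
      Filter.eventually_all.mpr fun k => hf.iteratedDeriv k
    filter_upwards [hev, hfk] with t ht hft
    have hv : (fun k : Fin l => iteratedDeriv k f t) = (B t).mulVec a := by
      funext k
      rw [hft k, iteratedDeriv_linear_combination ht]
      simp [Matrix.mulVec, dotProduct, hB, mul_comm]
    have hadj : (B t).adjugate.mulVec (fun k : Fin l => iteratedDeriv k f t) j₀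
        = (B t).det * a j₀ := by
      rw [hv, Matrix.mulVec_mulVec, Matrix.adjugate_mul, Matrix.smul_mulVec, Matrix.one_mulVec]
      rfl
    simp only [Finset.sum_apply, Pi.mul_apply, mul_assoc, ← Finset.mul_sum]
    change (B t).det = (a j₀)⁻¹ * (B t).adjugate.mulVec (fun k : Fin l => iteratedDeriv k f t) j₀
    rw [hadj]
    field_simp
  rw [analyticOrderAt_congr key]
  refine le_analyticOrderAt_sum _ fun k _ => ?_
  have hca : AnalyticAt ℂ (fun t => (a j₀)⁻¹ * (B t).adjugate j₀ k) t₀ :=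
    analyticAt_const.mul (analyticAt_matrix_adjugate hBa j₀ k)
  rw [analyticOrderAt_mul hca (hfa.iteratedDeriv' k)]
  refine le_add_left (analyticOrderAt_le_iteratedDeriv_add hfa (le_trans ?_ hd))
  exact_mod_cast (by omega : d + (k : ℕ) ≤ d + (l - 1))

/-- If the full Wronskian vanishes at `t` but that of the first `m` functions does not, the last
column is the combination of the others given by Cramer's rule in the first `m` rows. -/
theorem iteratedDeriv_last_eq_of_wronskian_eq_zero {m : ℕ} {z : Fin (m + 1) → ℂ → ℂ} {t : ℂ}
    (h0 : wronskian z t = 0) (h1 : wronskian (fun j : Fin m => z j.castSucc) t ≠ 0) :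
    ∃ v : Fin m → ℂ, ∀ k : Fin (m + 1),
      ∑ j, v j * iteratedDeriv (k : ℕ) (z j.castSucc) t = iteratedDeriv k (z (Fin.last m)) t := by
  obtain ⟨w, hw, hw0⟩ := Matrix.exists_mulVec_eq_zero_iff.mpr h0
  have hrow : ∀ k : Fin (m + 1), ∑ j : Fin m, iteratedDeriv (k : ℕ) (z j.castSucc) t *
      w j.castSucc + iteratedDeriv (k : ℕ) (z (Fin.last m)) t * w (Fin.last m) = 0 := fun k => by
    have := congrFun hw0 k
    simpa [Matrix.mulVec, dotProduct, Fin.sum_univ_castSucc] using this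
  have hl : w (Fin.last m) ≠ 0 := by
    intro hl
    have hv : (fun j : Fin m => w j.castSucc) = 0 := by
      refine Matrix.eq_zero_of_mulVec_eq_zero h1 (funext fun k => ?_)
      simpa [Matrix.mulVec, dotProduct, hl] using hrow k.castSucc
    exact hw (funext fun j => Fin.lastCases hl (fun i => congrFun hv i) j)
  refine ⟨fun j => -(w (Fin.last m))⁻¹ * w j.castSucc, fun k => ?_⟩
  have h := hrow k
  have e : ∑ j : Fin m, -(w (Fin.last m))⁻¹ * w j.castSucc * iteratedDeriv (k : ℕ) (z j.castSucc) t
      = -(w (Fin.last m))⁻¹ * ∑ j : Fin m, iteratedDeriv (k : ℕ) (z j.castSucc) t *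
        w j.castSucc := by
    rw [Finset.mul_sum]
    exact Finset.sum_congr rfl fun j _ => by ring
  rw [e, eq_neg_of_add_eq_zero_left h]
  field_simp

/-- Analytic functions on a connected open set whose Wronskian vanishes identically are linearly
dependent. -/
theorem exists_linear_relation_of_wronskian_eq_zero {U : Set ℂ} (hU : IsOpen U)
    (hUc : IsPreconnected U) (hUn : U.Nonempty) :
    ∀ {l : ℕ} (z : Fin l → ℂ → ℂ), (∀ j, AnalyticOnNhd ℂ (z j) U) →
      (∀ t ∈ U, wronskian z t = 0) →
      ∃ a : Fin l → ℂ, a ≠ 0 ∧ ∀ t ∈ U, ∑ j, a j * z j t = 0 := by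
  intro l
  induction l with
  | zero =>
    intro z _ hW
    obtain ⟨t, ht⟩ := hUn
    exact absurd (hW t ht) (by simp [wronskian])
  | succ m ih =>
    intro z hz hW
    by_cases hW' : ∀ t ∈ U, wronskian (fun j : Fin m => z j.castSucc) t = 0
    · obtain ⟨a, ha, h⟩ := ih (fun j => z j.castSucc) (fun j => hz _) hW'
      refine ⟨Fin.snoc a 0, fun h0 => ha (funext fun j => ?_), fun t ht => ?_⟩
      · simpa using congrFun h0 j.castSucc
      · simpa [Fin.sum_univ_castSucc] using h t ht
    push Not at hW'
    obtain ⟨t₁, ht₁, hne⟩ := hW'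
    have hWa : ∀ t ∈ U, AnalyticAt ℂ (wronskian fun j : Fin m => z j.castSucc) t :=
      fun t ht => analyticAt_wronskian fun j => hz _ t ht
    obtain ⟨r, hr, hball⟩ := Metric.eventually_nhds_iff_ball.mp
      ((hU.eventually_mem ht₁).and ((hWa t₁ ht₁).continuousAt.eventually_ne hne))
    set V := Metric.ball t₁ r with hV
    set A : ℂ → Matrix (Fin m) (Fin m) ℂ :=
      fun t => Matrix.of fun k j : Fin m => iteratedDeriv (k : ℕ) (z j.castSucc) t with hA
    set b : ℂ → Fin m → ℂ := fun t k => iteratedDeriv (k : ℕ) (z (Fin.last m)) t with hb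
    set c : ℂ → Fin m → ℂ := fun t j => (A t).det⁻¹ * ∑ k, (A t).adjugate j k * b t k with hc
    have hder : ∀ t ∈ U, ∀ j k, AnalyticAt ℂ (iteratedDeriv k (z j)) t :=
      fun t ht j k => (hz j t ht).iteratedDeriv' k
    have hca : ∀ t ∈ V, ∀ j, AnalyticAt ℂ (fun s => c s j) t := fun t ht j =>
      ((hWa t (hball t ht).1).inv (hball t ht).2).mul
        (Finset.analyticAt_fun_sum _ fun k _ =>
          (analyticAt_matrix_adjugate (fun p q => hder t (hball t ht).1 _ _) j k).mul
            (hder t (hball t ht).1 _ _))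
    have hrel : ∀ t ∈ V, ∀ k : Fin (m + 1),
        ∑ j, c t j * iteratedDeriv (k : ℕ) (z j.castSucc) t
          = iteratedDeriv k (z (Fin.last m)) t := by
      intro t ht
      have hdet : (A t).det ≠ 0 := (hball t ht).2
      obtain ⟨v, hv⟩ := iteratedDeriv_last_eq_of_wronskian_eq_zero (hW t (hball t ht).1) hdet
      suffices c t = v by rw [this]; exact hv
      have hbv : b t = (A t).mulVec v := by
        funext k
        simpa [Matrix.mulVec, dotProduct, hA, hb, mul_comm] using (hv k.castSucc).symm
      funext j
      change (A t).det⁻¹ * (A t).adjugate.mulVec (b t) j = v j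
      rw [hbv, Matrix.mulVec_mulVec, Matrix.adjugate_mul, Matrix.smul_mulVec, Matrix.one_mulVec,
        Pi.smul_apply, smul_eq_mul, inv_mul_cancel_left₀ hdet]
    have hc0 : ∀ t ∈ V, ∀ j, deriv (fun s => c s j) t = 0 := by
      intro t ht j
      refine congrFun (Matrix.eq_zero_of_mulVec_eq_zero (M := A t)
        (v := fun j => deriv (fun s => c s j) t) (hball t ht).2 (funext fun k => ?_)) j
      have hsum : HasDerivAt
          (fun s => ∑ j, c s j * iteratedDeriv (k : ℕ) (z j.castSucc) s)
          (∑ j, (deriv (fun s => c s j) t * iteratedDeriv (k : ℕ) (z j.castSucc) t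
            + c t j * iteratedDeriv (k + 1 : ℕ) (z j.castSucc) t)) t := by
        refine HasDerivAt.fun_sum fun j _ => ?_
        rw [iteratedDeriv_succ]
        exact (hca t ht j).differentiableAt.hasDerivAt.mul
          (hder t (hball t ht).1 _ _).differentiableAt.hasDerivAt
      have heq : (fun s => ∑ j, c s j * iteratedDeriv (k : ℕ) (z j.castSucc) s)
          =ᶠ[nhds t] iteratedDeriv (k : ℕ) (z (Fin.last m)) := by
        filter_upwards [Metric.isOpen_ball.mem_nhds ht] with s hs
        simpa using hrel s hs k.castSucc
      have h1 := hsum.deriv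
      rw [heq.deriv_eq, ← iteratedDeriv_succ, Finset.sum_add_distrib] at h1
      have h2 := hrel t ht k.succ
      rw [Fin.val_succ] at h2
      rw [h2] at h1
      simpa [Matrix.mulVec, dotProduct, hA, mul_comm] using h1
    have hconst : ∀ t ∈ V, c t = c t₁ := fun t ht => funext fun j =>
      Metric.isOpen_ball.is_const_of_deriv_eq_zero
        (convex_ball t₁ r).isPreconnected
        (fun s hs => (hca s hs j).differentiableAt.differentiableWithinAt)
        (fun s hs => hc0 s hs j) ht (Metric.mem_ball_self hr)
    refine ⟨Fin.snoc (c t₁) (-1), fun h0 => ?_, ?_⟩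
    · simpa using congrFun h0 (Fin.last m)
    · refine AnalyticOnNhd.eqOn_zero_of_preconnected_of_eventuallyEq_zero
        (fun t ht => Finset.analyticAt_fun_sum _ fun j _ => analyticAt_const.mul (hz j t ht))
        hUc ht₁ ?_
      filter_upwards [Metric.ball_mem_nhds t₁ hr] with t ht
      have := hrel t ht 0
      rw [hconst t ht] at this
      simpa [Fin.sum_univ_castSucc, add_neg_eq_zero] using this

/-- let `Γ₁ = γ, Γ₂, …, Γ_n` be analytic solutions of `x′ = M(t)x` forming a
fundamental system at `t₀`, `h` a linear form, `y_i = h∘Γ_i`, with `y₁ = h∘γ` not identically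
zero. If `(y_{i₁}, …, y_{i_l})` is a maximal linearly independent subfamily and `W` its
Wronskian, then `ord_{t₀}(h∘γ) ≤ n − 1 + ord_{t₀} W`. -/
theorem ord_linear_form_le_of_fundamental_system
    (n : ℕ) (hn : 1 ≤ n) (t₀ : ℂ)
    (M : ℂ → Matrix (Fin n) (Fin n) ℂ) (hM : ∀ i j, AnalyticAt ℂ (fun t => M t i j) t₀)
    (Γ : Fin n → ℂ → Fin n → ℂ)
    (hΓa : ∀ j i, AnalyticAt ℂ (fun t => Γ j t i) t₀)
    (hΓd : ∀ᶠ t in nhds t₀, ∀ j i,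
      HasDerivAt (fun s => Γ j s i) (∑ k, M t i k * Γ j t k) t)
    (hfund : (Matrix.of fun i j : Fin n => Γ j t₀ i).det ≠ 0)
    (c : Fin n → ℂ) (y : Fin n → ℂ → ℂ)
    (hy : ∀ j, y j = fun t => ∑ i, c i * Γ j t i)
    (hy1 : ¬ ∀ᶠ t in nhds t₀, y ⟨0, hn⟩ t = 0)
    (l : ℕ) (ι : Fin l → Fin n) (hι : Function.Injective ι)
    (hindep : ∀ a : Fin l → ℂ, (∀ᶠ t in nhds t₀, ∑ j, a j * y (ι j) t = 0) → a = 0)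
    (hmax : ∀ m : Fin n, ∃ a : Fin l → ℂ, ∀ᶠ t in nhds t₀, y m t = ∑ j, a j * y (ι j) t) :
    (¬ ∀ᶠ t in nhds t₀, wronskian (fun j => y (ι j)) t = 0) ∧
      ordAt (y ⟨0, hn⟩) t₀ ≤ n - 1 + ordAt (wronskian fun j => y (ι j)) t₀ := by
  have hya : ∀ j, AnalyticAt ℂ (y j) t₀ := fun j => by
    rw [hy j]
    exact Finset.analyticAt_fun_sum _ fun i _ => analyticAt_const.mul (hΓa j i)
  have hW : ¬ ∀ᶠ t in nhds t₀, wronskian (fun j => y (ι j)) t = 0 := by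
    intro h
    obtain ⟨r, hr, hball⟩ := Metric.eventually_nhds_iff_ball.mp
      (h.and (Filter.eventually_all.mpr fun j => (hya (ι j)).eventually_analyticAt))
    obtain ⟨a, ha, hrel⟩ := exists_linear_relation_of_wronskian_eq_zero Metric.isOpen_ball
      (convex_ball t₀ r).isPreconnected ⟨t₀, Metric.mem_ball_self hr⟩ (fun j => y (ι j))
      (fun j t ht => (hball t ht).2 j) (fun t ht => (hball t ht).1)
    exact ha (hindep a (by filter_upwards [Metric.ball_mem_nhds t₀ hr] with t ht using hrel t ht))
  refine ⟨hW, ?_⟩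
  obtain ⟨a, ha⟩ := hmax ⟨0, hn⟩
  obtain ⟨j₀, hj₀⟩ : ∃ j, a j ≠ 0 := by
    by_contra! h
    exact hy1 (by filter_upwards [ha] with t ht; simpa [h] using ht)
  have hl : l ≤ n := by simpa using Fintype.card_le_of_injective ι hι
  have hl0 : 0 < l := j₀.pos
  set d := ordAt (y ⟨0, hn⟩) t₀ with hd
  by_cases hdl : d ≤ l - 1
  · omega
  have key := le_analyticOrderAt_wronskian (d := d - (l - 1)) (fun j => hya (ι j)) hj₀ ha
    (by rw [Nat.sub_add_cancel (by omega), hd, natCast_ordAt (hya _) hy1])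
  rw [← natCast_ordAt (analyticAt_wronskian fun j => hya (ι j)) hW, Nat.cast_le] at key
  omega
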